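/- arXiv:2201.00772 — 4 statements merged into one kernel-verified Lean document; each statement's English description precedes it below -/
import Mathlib

section
/- Let f : ℝ → ℝ be twice continuously differentiable and let M ⊂ graph f = {(x, f(x)) : x ∈ ℝ} ⊂ ℝ² be nowhere dense in graph f (with the subspace topology). Then there exists a linearly continuous function g : ℝ² → ℝ such that M ⊂ D(g), where D(g) is the set of discontinuity points of g. -/
/-- A function `g : ℝ² → ℝ` is linearly continuous if it is continuous on every line. -/
def LinearlyContinuous2 (g : ℝ × ℝ → ℝ) : Prop :=
  ∀ a v : ℝ × ℝ, Continuous fun t : ℝ => g (a + t • v)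

open Set Filter Topology MeasureTheory

/-- A closed set `K` in the closure of `U` lies in the closure of a subset `S` of `U` all of whose
accumulation points outside of `S` lie in `K`. -/
theorem exists_subset_closure_subset_union {X : Type*} [MetricSpace X] [SecondCountableTopology X]
    {K U : Set X} (hK : IsClosed K) (hKU : K ⊆ closure U) :
    ∃ S ⊆ U, closure S ⊆ S ∪ K ∧ K ⊆ closure S := by
  rcases K.eq_empty_or_nonempty with rfl | hne
  · exact ⟨∅, by simp⟩
  have : Nonempty K := hne.to_subtype
  obtain ⟨u, hu⟩ := TopologicalSpace.exists_dense_seq K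
  have hex : ∀ m : ℕ, ∃ s ∈ U, dist (u m.unpair.1 : X) s < 1 / ((m : ℝ) + 1) := fun m =>
    Metric.mem_closure_iff.1 (hKU (u m.unpair.1).2) _ (by positivity)
  choose s hsU hs using hex
  refine ⟨range s, range_subset_iff.2 hsU, fun q hq => ?_, fun p hp => ?_⟩
  · by_contra hcon
    obtain ⟨hqs, hqK⟩ : q ∉ range s ∧ q ∉ K := by simpa using hcon
    obtain ⟨r, hr, hball⟩ := Metric.isOpen_iff.1 hK.isOpen_compl q hqK
    obtain ⟨N, hN⟩ := exists_nat_one_div_lt (half_pos hr)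
    have hfar : ∀ m, N ≤ m → r / 2 ≤ dist (s m) q := by
      intro m hm
      by_contra! hlt
      have h1 : 1 / ((m : ℝ) + 1) ≤ 1 / ((N : ℝ) + 1) := by gcongr
      have h2 : dist (u m.unpair.1 : X) q < r := by
        linarith [dist_triangle (u m.unpair.1 : X) (s m) q, hs m]
      exact hball h2 (u m.unpair.1).2
    have hfin : (s '' Iio N).Finite := (finite_Iio N).image s
    have hnhds : (s '' Iio N)ᶜ ∩ Metric.ball q (r / 2) ∈ 𝓝 q :=
      inter_mem (hfin.isClosed.isOpen_compl.mem_nhds fun h => hqs (image_subset_range _ _ h))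
        (Metric.ball_mem_nhds q (half_pos hr))
    obtain ⟨_, ⟨hx, hxb⟩, m, rfl⟩ := mem_closure_iff_nhds.1 hq _ hnhds
    rcases lt_or_ge m N with h | h
    · exact hx ⟨m, h, rfl⟩
    · exact (hfar m h).not_gt hxb
  · refine Metric.mem_closure_iff.2 fun ε hε => ?_
    obtain ⟨n, hn⟩ := Metric.denseRange_iff.1 hu ⟨p, hp⟩ (ε / 2) (half_pos hε)
    obtain ⟨k, hk⟩ := exists_nat_one_div_lt (half_pos hε)
    refine ⟨s (Nat.pair n k), mem_range_self _, ?_⟩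
    have h1 : 1 / ((Nat.pair n k : ℝ) + 1) ≤ 1 / ((k : ℝ) + 1) := by
      have := Nat.right_le_pair n k
      gcongr
    have h2 := hs (Nat.pair n k)
    rw [Nat.unpair_pair] at h2
    have h3 : dist p (u n : X) < ε / 2 := hn
    linarith [dist_triangle p (u n : X) (s (Nat.pair n k))]

/-- A closed set `K` in the closure of an open set `U` disjoint from `K` is the set of
discontinuities of some real function vanishing off `U`. -/
theorem exists_continuousAt_iff_notMem {X : Type*} [MetricSpace X] [SecondCountableTopology X]
    {K U : Set X} (hK : IsClosed K) (hU : IsOpen U) (hd : Disjoint K U) (hKU : K ⊆ closure U) :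
    ∃ g : X → ℝ, (∀ p, ContinuousAt g p ↔ p ∉ K) ∧ ∀ p ∉ U, g p = 0 := by
  rcases K.eq_empty_or_nonempty with rfl | hne
  · exact ⟨fun _ => 0, by simp [continuousAt_const]⟩
  obtain ⟨S, hSU, hSK, hKS⟩ := exists_subset_closure_subset_union hK hKU
  have hSne : S.Nonempty := closure_nonempty_iff.1 (hne.mono hKS)
  have hUne : Uᶜ.Nonempty := hne.mono hd.subset_compl_right
  have hzero : ∀ p ∉ U, Metric.infDist p Uᶜ = 0 := fun p hp => Metric.infDist_zero_of_mem hp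
  set g : X → ℝ := fun p => Metric.infDist p Uᶜ / (Metric.infDist p Uᶜ + Metric.infDist p S)
    with hg
  have hone : ∀ p ∈ S, g p = 1 := by
    intro p hp
    have hpos : 0 < Metric.infDist p Uᶜ :=
      (hU.isClosed_compl.notMem_iff_infDist_pos hUne).1 (by simpa using hSU hp)
    simp [hg, Metric.infDist_zero_of_mem hp, hpos.ne']
  refine ⟨g, fun p => ⟨fun hcont hp => ?_, fun hp => ?_⟩, fun p hp => by simp [hg, hzero p hp]⟩
  · have h0 : g p = 0 := by simp [hg, hzero p (hd.notMem_of_mem_left hp)]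
    have hlt : ∀ᶠ q in 𝓝 p, g q < 1 := hcont.eventually_lt_const (by rw [h0]; exact one_pos)
    obtain ⟨q, hq, hqS⟩ := mem_closure_iff_nhds.1 (hKS hp) _ hlt
    exact absurd (hone q hqS) (ne_of_lt hq)
  · have hc : ∀ s : Set X, ContinuousAt (fun q => Metric.infDist q s) p := fun s =>
      (Metric.continuous_infDist_pt s).continuousAt
    refine (hc _).div ((hc _).add (hc _)) fun h => ?_
    have h1 := Metric.infDist_nonneg (x := p) (s := Uᶜ)
    have h2 := Metric.infDist_nonneg (x := p) (s := S)
    have hpU : p ∈ Uᶜ := by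
      by_contra hpU
      have := (hU.isClosed_compl.notMem_iff_infDist_pos hUne).1 hpU
      linarith
    have hpS : p ∈ closure S :=
      (Metric.mem_closure_iff_infDist_zero hSne).2 (by linarith)
    exact (hSK hpS).elim (fun h => hpU (hSU h)) hp

/-- If every line through a point of the closed set `K` leaves the open set `U` near that point,
then `K` is the set of discontinuities of a linearly continuous function. -/
theorem exists_linearlyContinuous2_of_isOpen {K U : Set (ℝ × ℝ)} (hK : IsClosed K) (hU : IsOpen U)
    (hd : Disjoint K U) (hKU : K ⊆ closure U)
    (hline : ∀ p ∈ K, ∀ v : ℝ × ℝ, ∀ᶠ t : ℝ in 𝓝[≠] 0, p + t • v ∉ U) :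
    ∃ g : ℝ × ℝ → ℝ, LinearlyContinuous2 g ∧ ∀ p, ContinuousAt g p ↔ p ∉ K := by
  obtain ⟨g, hg, hg0⟩ := exists_continuousAt_iff_notMem hK hU hd hKU
  refine ⟨g, fun a v => continuous_iff_continuousAt.2 fun t₀ => ?_, hg⟩
  by_cases hp : a + t₀ • v ∈ K
  · have h1 : ∀ᶠ t : ℝ in 𝓝 0, a + t₀ • v + t • v ∉ U := by
      have := eventually_nhdsWithin_iff.1 (hline _ hp v)
      filter_upwards [this] with t ht
      rcases eq_or_ne t 0 with rfl | h
      · simpa using hd.notMem_of_mem_left hp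
      · exact ht h
    have h2 : Tendsto (fun t : ℝ => t - t₀) (𝓝 t₀) (𝓝 0) := by
      have : Continuous fun t : ℝ => t - t₀ := by fun_prop
      simpa using this.tendsto t₀
    have h3 : (fun t : ℝ => g (a + t • v)) =ᶠ[𝓝 t₀] fun _ => 0 := by
      filter_upwards [h2.eventually h1] with t ht
      refine hg0 _ ?_
      have : a + t₀ • v + (t - t₀) • v = a + t • v := by module
      rwa [← this]
    exact continuousAt_const.congr h3.symm
  · exact ContinuousAt.comp (f := fun t : ℝ => a + t • v) ((hg _).2 hp)
      (by fun_prop)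

/-- The union of the tangent lines of the graph of `f` at its points with vanishing second
derivative, each cut off at horizontal distance `1` from the point of tangency. -/
def flatTangents (f : ℝ → ℝ) : Set (ℝ × ℝ) :=
  {p | ∃ a, |a - p.1| ≤ 1 ∧ deriv (deriv f) a = 0 ∧ p.2 = f a + deriv f a * (p.1 - a)}

theorem isClosed_flatTangents {f : ℝ → ℝ} (h0 : Continuous f) (h1 : Continuous (deriv f))
    (h2 : Continuous (deriv (deriv f))) : IsClosed (flatTangents f) := by
  have hcl : IsClosed {q : Icc (-1 : ℝ) 1 × (ℝ × ℝ) | deriv (deriv f) (q.2.1 + q.1) = 0 ∧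
      q.2.2 = f (q.2.1 + q.1) + deriv f (q.2.1 + q.1) * (-(q.1 : ℝ))} :=
    (isClosed_eq (by fun_prop) (by fun_prop)).inter (isClosed_eq (by fun_prop) (by fun_prop))
  convert isClosedMap_snd_of_compactSpace _ hcl using 1
  ext p
  constructor
  · rintro ⟨a, ha, hz, hp⟩
    refine ⟨(⟨a - p.1, abs_le.1 ha⟩, p), ⟨by simpa using hz, ?_⟩, rfl⟩
    simpa using hp
  · rintro ⟨⟨⟨s, hs⟩, p⟩, ⟨hz, hp⟩, rfl⟩
    exact ⟨p.1 + s, by simpa [abs_le] using hs, hz, by simpa using hp⟩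

/-- Sard's lemma for the values of the flat tangents over a fixed point. -/
theorem dense_compl_slice_flatTangents {f : ℝ → ℝ} (hf : ContDiff ℝ 2 f) (x : ℝ) :
    Dense {y | (x, y) ∉ flatTangents f} := by
  have hf1 : Differentiable ℝ f := hf.differentiable (by norm_num)
  have hf2 : Differentiable ℝ (deriv f) :=
    (contDiff_succ_iff_deriv.1 (show ContDiff ℝ (1 + 1) f from hf)).2.2.differentiable (by norm_num)
  have hder : ∀ a ∈ {a | deriv (deriv f) a = 0},
      HasDerivWithinAt (fun a => f a + deriv f a * (x - a)) 0 {a | deriv (deriv f) a = 0} a := by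
    intro a ha
    have h := (hf1 a).hasDerivAt.add
      ((hf2 a).hasDerivAt.mul ((hasDerivAt_id a).const_sub x))
    rw [show deriv (deriv f) a = 0 from ha] at h
    exact (h.congr_deriv (by simp)).hasDerivWithinAt
  have hnull := addHaar_image_eq_zero_of_det_fderivWithin_eq_zero volume
    (fun a ha => (hder a ha).hasFDerivWithinAt) (fun a _ => by simp)
  refine Measure.dense_of_ae (μ := volume) ?_
  refine measure_mono_null ?_ hnull
  intro y hy
  obtain ⟨a, -, hz, hy⟩ : (x, y) ∈ flatTangents f := by simpa using hy
  exact ⟨a, hz, hy.symm⟩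

/-- Near a point with nonvanishing second derivative, the graph lies strictly on the side of the
tangent line given by the sign of the second derivative. -/
theorem eventually_tangent_sub_mul_deriv_deriv_neg {f : ℝ → ℝ} (hf : ContDiff ℝ 2 f)
    (h2 : Continuous (deriv (deriv f))) {a : ℝ} (ha : deriv (deriv f) a ≠ 0) :
    ∀ᶠ x in 𝓝[≠] a, (f a + deriv f a * (x - a) - f x) * deriv (deriv f) x < 0 := by
  have ht := (taylor_isLittleO_univ (x₀ := a) (n := 2) hf).tendsto_div_nhds_zero
  have ht' : Tendsto (fun x => (f x - taylorWithinEval f 2 univ a x) / (x - a) ^ 2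
      + deriv (deriv f) a / 2) (𝓝[≠] a) (𝓝 (0 + deriv (deriv f) a / 2)) :=
    (ht.mono_left nhdsWithin_le_nhds).add_const _
  have hmul := ht'.mul ((h2.tendsto a).mono_left nhdsWithin_le_nhds)
  have hpos : 0 < (0 + deriv (deriv f) a / 2) * deriv (deriv f) a := by
    have := mul_self_pos.2 ha
    linarith
  filter_upwards [hmul.eventually_const_lt hpos, self_mem_nhdsWithin] with x hx hxa
  have hne : x - a ≠ 0 := sub_ne_zero.2 hxa
  have hsq : 0 < (x - a) ^ 2 := by positivity
  have hT : taylorWithinEval f 2 univ a x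
      = f a + deriv f a * (x - a) + deriv (deriv f) a / 2 * (x - a) ^ 2 := by
    simp [taylorWithinEval_succ, iteratedDerivWithin_univ, iteratedDeriv_succ]
    ring
  have hkey := mul_pos hx hsq
  rw [hT] at hkey
  field_simp at hkey
  nlinarith

/-- A line through `(a, f a)` other than the tangent leaves the parabolic neighbourhood of the
graph of `f` given by the squared horizontal distance to `a`. -/
theorem eventually_sq_lt_abs_of_ne_deriv {f : ℝ → ℝ} {a : ℝ} (hf : DifferentiableAt ℝ f a)
    {v : ℝ × ℝ} (hv : v.2 ≠ deriv f a * v.1) :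
    ∀ᶠ t : ℝ in 𝓝[≠] 0, (t * v.1) ^ 2 < |f a + t * v.2 - f (a + t * v.1)| := by
  have hd : HasDerivAt (fun t : ℝ => f a + t * v.2 - f (a + t * v.1))
      (v.2 - deriv f a * v.1) 0 := by
    have h1 : HasDerivAt (fun t : ℝ => a + t * v.1) v.1 0 := by
      simpa using ((hasDerivAt_id (0 : ℝ)).mul_const v.1).const_add a
    have h2 : HasDerivAt (fun t : ℝ => f a + t * v.2) v.2 0 := by
      simpa using ((hasDerivAt_id (0 : ℝ)).mul_const v.2).const_add (f a)
    have hf' : HasDerivAt f (deriv f a) (a + 0 * v.1) := by simpa using hf.hasDerivAt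
    exact h2.sub (hf'.comp (0 : ℝ) h1)
  have hs := (hasDerivAt_iff_tendsto_slope.1 hd).abs
  have hq : Tendsto (fun t : ℝ => |t| * v.1 ^ 2) (𝓝[≠] 0) (𝓝 0) := by
    have : Continuous fun t : ℝ => |t| * v.1 ^ 2 := by fun_prop
    simpa using (this.tendsto 0).mono_left nhdsWithin_le_nhds
  filter_upwards [hq.eventually_lt hs (abs_pos.2 (sub_ne_zero.2 hv)), self_mem_nhdsWithin]
    with t ht ht0
  have htp : 0 < |t| := abs_pos.2 ht0
  simp only [slope_def_field, zero_mul, add_zero, sub_self, sub_zero, abs_div] at ht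
  rw [lt_div_iff₀ htp] at ht
  calc (t * v.1) ^ 2 = |t| * v.1 ^ 2 * |t| := by rw [mul_pow, ← sq_abs t]; ring
    _ < _ := ht

/-- The points close to the graph of `f` relative to their horizontal distance to `P`, off the
flat tangents and on the convex side of the graph. -/
def graphCollar (f : ℝ → ℝ) (P : Set ℝ) : Set (ℝ × ℝ) :=
  {p | |p.2 - f p.1| < Metric.infDist p.1 P ^ 2} ∩ (flatTangents f)ᶜ ∩
    interior {p | 0 ≤ (p.2 - f p.1) * deriv (deriv f) p.1}

theorem isOpen_graphCollar {f : ℝ → ℝ} (h0 : Continuous f) (h1 : Continuous (deriv f))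
    (h2 : Continuous (deriv (deriv f))) (P : Set ℝ) : IsOpen (graphCollar f P) := by
  have hd : Continuous fun p : ℝ × ℝ => Metric.infDist p.1 P :=
    (Metric.continuous_infDist_pt P).comp continuous_fst
  exact ((isOpen_lt (by fun_prop) (by fun_prop)).inter
    (isClosed_flatTangents h0 h1 h2).isOpen_compl).inter isOpen_interior

theorem eventually_notMem_graphCollar {f : ℝ → ℝ} (hf : ContDiff ℝ 2 f)
    (h2 : Continuous (deriv (deriv f))) {P : Set ℝ} {a : ℝ} (ha : a ∈ P) (v : ℝ × ℝ) :
    ∀ᶠ t : ℝ in 𝓝[≠] 0, (a, f a) + t • v ∉ graphCollar f P := by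
  have hdist : ∀ x, Metric.infDist x P ^ 2 ≤ (x - a) ^ 2 := fun x => by
    have h := Metric.infDist_le_dist_of_mem (x := x) ha
    rw [Real.dist_eq] at h
    rw [← sq_abs (x - a)]
    exact pow_le_pow_left₀ Metric.infDist_nonneg h 2
  by_cases hv : v.2 = deriv f a * v.1
  · rcases eq_or_ne v.1 0 with hv1 | hv1
    · refine Eventually.of_forall fun t ht => ?_
      have h := ht.1.1.trans_le (hdist _)
      refine absurd h (not_lt.2 ?_)
      simpa [hv1] using mul_nonneg (abs_nonneg t) (abs_nonneg v.2)
    have hcont : Continuous fun t : ℝ => a + t * v.1 := by fun_prop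
    by_cases hz : deriv (deriv f) a = 0
    · have hnear : ∀ᶠ t : ℝ in 𝓝 0, |a - (a + t * v.1)| < 1 := by
        have : Continuous fun t : ℝ => |a - (a + t * v.1)| := by fun_prop
        exact (this.tendsto 0).eventually_lt_const (by simp)
      filter_upwards [nhdsWithin_le_nhds hnear] with t ht hmem
      refine hmem.1.2 ⟨a, by simpa using ht.le, hz, ?_⟩
      simp [hv]
      ring
    · have htend : Tendsto (fun t : ℝ => a + t * v.1) (𝓝[≠] 0) (𝓝[≠] a) := by
        refine tendsto_nhdsWithin_iff.2 ⟨?_, ?_⟩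
        · simpa using (hcont.tendsto 0).mono_left nhdsWithin_le_nhds
        · filter_upwards [self_mem_nhdsWithin] with t ht
          simpa [hv1] using ht
      filter_upwards [htend.eventually (eventually_tangent_sub_mul_deriv_deriv_neg hf h2 hz)]
        with t ht hmem
      have h : 0 ≤ (f a + t * v.2 - f (a + t * v.1)) * deriv (deriv f) (a + t * v.1) := by
        simpa using interior_subset hmem.2
      rw [hv] at h
      ring_nf at h ht
      linarith
  · filter_upwards [eventually_sq_lt_abs_of_ne_deriv
      (hf.differentiable (by norm_num)).differentiableAt hv] with t ht hmem
    have h := hmem.1.1.trans_le (hdist _)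
    simp at h
    linarith

theorem mk_mem_closure_graphCollar {f : ℝ → ℝ} (hf : ContDiff ℝ 2 f)
    (h2 : Continuous (deriv (deriv f))) {P : Set ℝ} (hP : IsClosed P) (hne : P.Nonempty)
    {x : ℝ} (hx : x ∉ P) (hx' : x ∉ frontier {x | deriv (deriv f) x = 0}) :
    (x, f x) ∈ closure (graphCollar f P) := by
  have h0 : Continuous f := hf.continuous
  have hpos : 0 < Metric.infDist x P := (hP.notMem_iff_infDist_pos hne).1 hx
  have hint : ∀ y, (y - f x) * deriv (deriv f) x > 0 ∨ deriv (deriv f) x = 0 →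
      (x, y) ∈ interior {p : ℝ × ℝ | 0 ≤ (p.2 - f p.1) * deriv (deriv f) p.1} := by
    rintro y (hy | hy)
    · have hopen : IsOpen {p : ℝ × ℝ | 0 < (p.2 - f p.1) * deriv (deriv f) p.1} :=
        isOpen_lt continuous_const
          ((continuous_snd.sub (h0.comp continuous_fst)).mul (h2.comp continuous_fst))
      have hsub : {p : ℝ × ℝ | 0 < (p.2 - f p.1) * deriv (deriv f) p.1} ⊆
          {p | 0 ≤ (p.2 - f p.1) * deriv (deriv f) p.1} := fun p hp => le_of_lt (mem_ofPred.1 hp)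
      exact interior_maximal hsub hopen hy
    · have hxi : x ∈ interior {x | deriv (deriv f) x = 0} := by
        by_contra hcon
        exact hx' ⟨subset_closure hy, hcon⟩
      refine interior_maximal (fun p hp => ?_) (isOpen_interior.preimage continuous_fst) hxi
      have : p.1 ∈ {x | deriv (deriv f) x = 0} := interior_subset hp
      have : deriv (deriv f) p.1 = 0 := this
      simp [this]
  refine Metric.mem_closure_iff.2 fun ε hε => ?_
  set η := min (Metric.infDist x P ^ 2) ε
  have hη0 : 0 < η := lt_min (by positivity) hε
  obtain ⟨y, hyF, hyη, hys⟩ : ∃ y, (x, y) ∉ flatTangents f ∧ |y - f x| < η ∧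
      ((y - f x) * deriv (deriv f) x > 0 ∨ deriv (deriv f) x = 0) := by
    rcases lt_or_ge (deriv (deriv f) x) 0 with hneg | hnn
    · obtain ⟨y, hy, h1, h2⟩ := (dense_compl_slice_flatTangents hf x).exists_between
        (show f x - η < f x by linarith)
      exact ⟨y, hy, abs_lt.2 ⟨by linarith, by linarith⟩,
        Or.inl (mul_pos_of_neg_of_neg (by linarith) hneg)⟩
    · obtain ⟨y, hy, h1, h2⟩ := (dense_compl_slice_flatTangents hf x).exists_between
        (show f x < f x + η by linarith)
      refine ⟨y, hy, abs_lt.2 ⟨by linarith, by linarith⟩, ?_⟩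
      rcases hnn.eq_or_lt with h | h
      · exact Or.inr h.symm
      · exact Or.inl (mul_pos (by linarith) h)
  refine ⟨(x, y), ⟨⟨hyη.trans_le (min_le_left _ _), hyF⟩, hint y hys⟩, ?_⟩
  rw [dist_comm, dist_prod_same_left, Real.dist_eq]
  exact hyη.trans_le (min_le_right _ _)

theorem stmt_15 (f : ℝ → ℝ) (hf : ContDiff ℝ 2 f)
    (M : Set (ℝ × ℝ)) (hM : M ⊆ {p : ℝ × ℝ | p.2 = f p.1})
    (hnd : IsNowhereDense ((Subtype.val ⁻¹' M) : Set {p : ℝ × ℝ | p.2 = f p.1})) :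
    ∃ g : ℝ × ℝ → ℝ, LinearlyContinuous2 g ∧ M ⊆ {p | ¬ ContinuousAt g p} := by
  have hf' : ContDiff ℝ 1 (deriv f) :=
    (contDiff_succ_iff_deriv.1 (show ContDiff ℝ (1 + 1) f from hf)).2.2
  have h0 : Continuous f := hf.continuous
  have h1 : Continuous (deriv f) := hf'.continuous
  have h2 : Continuous (deriv (deriv f)) := hf'.continuous_deriv le_rfl
  have hemb : IsEmbedding fun p : {p : ℝ × ℝ | p.2 = f p.1} => p.1.1 :=
    Function.LeftInverse.isEmbedding (f := fun x => ⟨(x, f x), rfl⟩)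
      (fun p => Subtype.ext (Prod.ext rfl p.2.symm)) (by fun_prop) (by fun_prop)
  set P : Set ℝ := closure ((fun p : {p : ℝ × ℝ | p.2 = f p.1} => p.1.1) '' (Subtype.val ⁻¹' M))
  have hP : IsClosed P := isClosed_closure
  have hPd : Dense Pᶜ :=
    interior_eq_empty_iff_dense_compl.1 (hemb.isInducing.isNowhereDense_image hnd)
  have hMP : ∀ p ∈ M, p.1 ∈ P := fun p hp => subset_closure ⟨⟨p, hM hp⟩, hp, rfl⟩
  set Z : Set ℝ := {x | deriv (deriv f) x = 0}
  have hZ : IsClosed Z := isClosed_eq h2 continuous_const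
  have hD : Dense (Pᶜ ∩ (frontier Z)ᶜ) :=
    hPd.inter_of_isOpen_left (interior_eq_empty_iff_dense_compl.1 (interior_frontier hZ))
      hP.isOpen_compl
  have hK : IsClosed {p : ℝ × ℝ | p.1 ∈ P ∧ p.2 = f p.1} :=
    (hP.preimage continuous_fst).inter (isClosed_eq (by fun_prop) (by fun_prop))
  obtain ⟨g, hg, hgK⟩ := exists_linearlyContinuous2_of_isOpen hK (isOpen_graphCollar h0 h1 h2 P)
    (disjoint_left.2 fun p hp hpU => by
      have h := hpU.1.1
      rw [mem_ofPred, Metric.infDist_zero_of_mem hp.1, zero_pow two_ne_zero] at h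
      exact absurd h (not_lt.2 (abs_nonneg _)))
    (by
      rintro ⟨b, y⟩ ⟨hb, hy : y = f b⟩
      subst hy
      have hcl : IsClosed {x | (x, f x) ∈ closure (graphCollar f P)} :=
        isClosed_closure.preimage (by fun_prop)
      exact hcl.closure_subset_iff.2
        (fun x hx => mk_mem_closure_graphCollar hf h2 hP ⟨b, hb⟩ hx.1 hx.2) (hD b))
    (by
      rintro ⟨b, y⟩ ⟨hb, hy : y = f b⟩ v
      subst hy
      exact eventually_notMem_graphCollar hf h2 hb v)
  exact ⟨g, hg, fun p hp hc => (hgK p).1 hc ⟨hMP p hp, hM hp⟩⟩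
end

section
/- There exist a differentiable function f : ℝ → ℝ whose derivative is bounded and a set M ⊂ graph f = {(x, f(x)) : x ∈ ℝ} ⊂ ℝ² nowhere dense in graph f (with the subspace topology) such that there does not exist any linearly continuous function g : ℝ² → ℝ with M ⊂ D(g), where D(g) is the set of discontinuity points of g. -/
open Set Filter Topology MeasureTheory

/-- The Takagi function. -/
noncomputable def takagi (u : ℝ) : ℝ :=
  ∑' j : ℕ, (1 / 2 : ℝ) ^ j * ‖((2 ^ j * u : ℝ) : UnitAddCircle)‖

lemma UnitAddCircle.norm_le_one (x : UnitAddCircle) : ‖x‖ ≤ 1 := by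
  have h := AddCircle.norm_le_half_period (1 : ℝ) (x := x) one_ne_zero
  norm_num at h
  linarith

lemma takagi_term_le (u : ℝ) (j : ℕ) :
    (1 / 2 : ℝ) ^ j * ‖((2 ^ j * u : ℝ) : UnitAddCircle)‖ ≤ (1 / 2 : ℝ) ^ j :=
  mul_le_of_le_one_right (by positivity) (UnitAddCircle.norm_le_one _)

lemma summable_takagi (u : ℝ) :
    Summable fun j : ℕ => (1 / 2 : ℝ) ^ j * ‖((2 ^ j * u : ℝ) : UnitAddCircle)‖ :=
  Summable.of_nonneg_of_le (fun _ => by positivity) (takagi_term_le u) summable_geometric_two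

lemma continuous_takagi : Continuous takagi := by
  refine continuous_tsum (u := fun j : ℕ => (1 / 2 : ℝ) ^ j) (fun j => ?_)
    summable_geometric_two fun j u => ?_
  · have h : Continuous fun u : ℝ => ((2 ^ j * u : ℝ) : UnitAddCircle) :=
      (AddCircle.continuous_mk' (1 : ℝ)).comp (by fun_prop)
    fun_prop
  · rw [Real.norm_of_nonneg (by positivity)]
    exact takagi_term_le u j

lemma abs_takagi_le (u : ℝ) : |takagi u| ≤ 2 := by
  rw [abs_of_nonneg (tsum_nonneg fun _ => by positivity), ← tsum_geometric_two]
  exact (summable_takagi u).tsum_le_tsum (takagi_term_le u) summable_geometric_two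

lemma takagi_dyadic_lt (k : ℤ) {n m : ℕ} (hm : 2 * n < m) {h : ℝ} (hh : |h| = (1 / 2 : ℝ) ^ m) :
    takagi (k / 2 ^ n) < takagi (k / 2 ^ n + h) := by
  set u : ℝ := k / 2 ^ n with hu
  set F : ℕ → ℝ := fun j => (1 / 2 : ℝ) ^ j * ‖((2 ^ j * (u + h) : ℝ) : UnitAddCircle)‖ -
    (1 / 2 : ℝ) ^ j * ‖((2 ^ j * u : ℝ) : UnitAddCircle)‖ with hF
  have hsum : Summable F := (summable_takagi _).sub (summable_takagi _)
  have hdiff : takagi (u + h) - takagi u = ∑' j, F j :=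
    ((summable_takagi _).tsum_sub (summable_takagi _)).symm
  have half_mul (j : ℕ) : (1 / 2 : ℝ) ^ j * 2 ^ j = 1 := by rw [← mul_pow]; norm_num
  have hzero : ∀ j, n ≤ j → ((2 ^ j * u : ℝ) : UnitAddCircle) = 0 := by
    intro j hj
    obtain ⟨i, rfl⟩ := Nat.exists_eq_add_of_le hj
    have : (2 ^ (n + i) * u : ℝ) = ((2 ^ i * k : ℤ) : ℝ) := by
      rw [hu, pow_add]; push_cast; field_simp
    rw [this, AddCircle.coe_eq_zero_iff]
    exact ⟨2 ^ i * k, by simp⟩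
  have hlow : ∀ j, -|h| ≤ F j := by
    intro j
    have h1 : ‖((2 ^ j * u : ℝ) : UnitAddCircle)‖ ≤
        ‖((2 ^ j * (u + h) : ℝ) : UnitAddCircle)‖ + 2 ^ j * |h| := by
      have h2 : ((2 ^ j * u : ℝ) : UnitAddCircle) =
          ((2 ^ j * (u + h) : ℝ) : UnitAddCircle) - ((2 ^ j * h : ℝ) : UnitAddCircle) := by
        rw [← AddCircle.coe_sub]; congr 1; ring
      have h3 : ‖((2 ^ j * h : ℝ) : UnitAddCircle)‖ ≤ 2 ^ j * |h| := by
        refine (QuotientAddGroup.norm_mk_le_norm).trans ?_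
        rw [Real.norm_eq_abs, abs_mul, abs_of_nonneg (by positivity)]
      rw [h2]
      exact (norm_sub_le _ _).trans (by gcongr)
    have h4 := mul_le_mul_of_nonneg_left h1 (by positivity : (0 : ℝ) ≤ (1 / 2) ^ j)
    have h5 : (1 / 2 : ℝ) ^ j * (2 ^ j * |h|) = |h| := by rw [← mul_assoc, half_mul, one_mul]
    rw [mul_add, h5] at h4
    simp only [hF]
    linarith
  have hshift : ∀ j, n ≤ j → F j = (1 / 2 : ℝ) ^ j * ‖((2 ^ j * h : ℝ) : UnitAddCircle)‖ := by
    intro j hj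
    simp only [hF]
    rw [mul_add, AddCircle.coe_add, hzero j hj]
    simp
  have hmid : ∀ j, n ≤ j → j < m → F j = |h| := by
    intro j hj hjm
    have habs : |2 ^ j * h| = 2 ^ j * |h| := by rw [abs_mul, abs_of_nonneg (by positivity)]
    have hnorm : ‖((2 ^ j * h : ℝ) : UnitAddCircle)‖ = |2 ^ j * h| := by
      refine (AddCircle.norm_coe_eq_abs_iff (1 : ℝ) one_ne_zero).2 ?_
      obtain ⟨i, rfl⟩ := Nat.exists_eq_add_of_lt hjm
      rw [habs, hh, abs_one, pow_succ, pow_add, ← mul_assoc, ← mul_assoc, mul_comm (2 ^ j),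
        half_mul, one_mul]
      have : (1 / 2 : ℝ) ^ i ≤ 1 := pow_le_one₀ (by norm_num) (by norm_num)
      linarith
    rw [hshift j hj, hnorm, habs, ← mul_assoc, half_mul, one_mul]
  have hle : ∑ j ∈ Finset.range m, F j ≤ ∑' j, F j := by
    refine hsum.sum_le_tsum _ fun j hj => ?_
    rw [Finset.mem_range, not_lt] at hj
    rw [hshift j (by omega)]
    positivity
  have hnm : n ≤ m := by omega
  rw [← Finset.sum_range_add_sum_Ico _ hnm] at hle
  have hA : -(n * |h|) ≤ ∑ j ∈ Finset.range n, F j := by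
    have := Finset.card_nsmul_le_sum (Finset.range n) F (-|h|) fun j _ => hlow j
    simpa using this
  have hB : ∑ j ∈ Finset.Ico n m, F j = (m - n) * |h| := by
    rw [Finset.sum_congr rfl fun j hj =>
      hmid j (Finset.mem_Ico.1 hj).1 (Finset.mem_Ico.1 hj).2]
    simp [Nat.cast_sub hnm]
  have hpos : 0 < |h| := by rw [hh]; positivity
  have hmn : (2 * n : ℝ) < m := by exact_mod_cast hm
  nlinarith

lemma exists_valley_takagi {α β : ℝ} (hαβ : α < β) :
    ∃ a b c, α < a ∧ a < b ∧ b < c ∧ c < β ∧ takagi b < takagi a ∧ takagi b < takagi c := by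
  obtain ⟨n, hn⟩ := exists_pow_lt_of_lt_one (show 0 < (β - α) / 2 by linarith)
    (show (1 / 2 : ℝ) < 1 by norm_num)
  set k : ℤ := ⌊α * 2 ^ n⌋ + 1 with hk
  have h2 : (0 : ℝ) < 2 ^ n := by positivity
  have hαk : α < k / 2 ^ n := by
    rw [lt_div_iff₀ h2, hk]; push_cast; exact Int.lt_floor_add_one _
  have hkβ : k / 2 ^ n < β := by
    rw [one_div, inv_pow, inv_lt_iff_one_lt_mul₀ h2] at hn
    rw [div_lt_iff₀ h2, hk]
    push_cast
    have := Int.floor_le (α * 2 ^ n)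
    nlinarith
  obtain ⟨m, hm⟩ := exists_pow_lt_of_lt_one
    (show 0 < min (k / 2 ^ n - α) (β - k / 2 ^ n) from lt_min (by linarith) (by linarith))
    (show (1 / 2 : ℝ) < 1 by norm_num)
  set h : ℝ := (1 / 2) ^ (m + (2 * n + 1)) with hh
  have hpos : 0 < h := by positivity
  have hle : h ≤ (1 / 2) ^ m := pow_le_pow_of_le_one (by norm_num) (by norm_num) (by omega)
  obtain ⟨h3, h4⟩ := lt_min_iff.1 (hle.trans_lt hm)
  refine ⟨k / 2 ^ n + -h, k / 2 ^ n, k / 2 ^ n + h, by linarith, by linarith, by linarith,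
    by linarith, takagi_dyadic_lt k (m := m + (2 * n + 1)) (by omega) ?_,
    takagi_dyadic_lt k (m := m + (2 * n + 1)) (by omega) ?_⟩
  · rw [abs_neg, abs_of_pos hpos]
  · rw [abs_of_pos hpos]

/-- The set of points at which `ψ` is not locally constant. -/
def varyingSet (ψ : ℝ → ℝ) : Set ℝ := {x | ¬ ∀ᶠ y in 𝓝 x, ψ y = ψ x}

lemma isClosed_varyingSet (ψ : ℝ → ℝ) : IsClosed (varyingSet ψ) := by
  rw [← isOpen_compl_iff, isOpen_iff_mem_nhds]
  intro x hx
  have hx' : ∀ᶠ y in 𝓝 x, ψ y = ψ x := not_not.1 hx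
  filter_upwards [hx'.eventually_nhds, hx'] with y hy hyx
  refine not_not.2 ?_
  filter_upwards [hy] with z hz
  rw [hz, hyx]

lemma exists_lt_of_mem_varyingSet {ψ : ℝ → ℝ} (hmono : Monotone ψ) {x ρ : ℝ}
    (hx : x ∈ varyingSet ψ) (hρ : 0 < ρ) :
    ∃ s t, x - ρ < s ∧ s < t ∧ t < x + ρ ∧ ψ s < ψ t := by
  obtain ⟨y, hy, hyx⟩ : ∃ y, y ∈ Ioo (x - ρ) (x + ρ) ∧ ψ y ≠ ψ x := by
    by_contra! h
    exact hx (eventually_of_mem (Ioo_mem_nhds (by linarith) (by linarith)) h)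
  rcases lt_trichotomy y x with h | h | h
  · exact ⟨y, x, hy.1, h, by linarith, lt_of_le_of_ne (hmono h.le) hyx⟩
  · exact absurd (congrArg ψ h) hyx
  · exact ⟨x, y, by linarith, h, hy.2, lt_of_le_of_ne (hmono h.le) hyx.symm⟩

lemma exists_mem_varyingSet_eq {ψ : ℝ → ℝ} (hψ : Continuous ψ) {s t u : ℝ} (hst : s ≤ t)
    (hsu : ψ s < u) (hut : u ≤ ψ t) : ∃ r ∈ varyingSet ψ, s ≤ r ∧ r ≤ t ∧ ψ r = u := by
  set K : Set ℝ := Icc s t ∩ ψ ⁻¹' {u}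
  have hK : IsCompact K := isCompact_Icc.inter_right (isClosed_singleton.preimage hψ)
  have hne : K.Nonempty := by
    obtain ⟨r, hr, hru⟩ := intermediate_value_Icc hst hψ.continuousOn ⟨hsu.le, hut⟩
    exact ⟨r, hr, hru⟩
  obtain ⟨r, ⟨hr, hru : ψ r = u⟩, hmin⟩ := hK.exists_isLeast hne
  refine ⟨r, fun hconst => ?_, hr.1, hr.2, hru⟩
  have hsr : s < r := lt_of_le_of_ne hr.1 (by rintro rfl; exact hsu.ne hru)
  obtain ⟨l, hl, hlconst⟩ := exists_Ioc_subset_of_mem_nhds hconst ⟨s, hsr⟩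
  obtain ⟨y, hy, hyr⟩ := exists_between (max_lt hl hsr)
  have hyK : y ∈ K := ⟨⟨((le_max_right _ _).trans_lt hy).le, hyr.le.trans hr.2⟩,
    (hlconst ⟨(le_max_left _ _).trans_lt hy, hyr.le⟩).trans hru⟩
  exact (hmin hyK).not_gt hyr

lemma exists_cantor_like_function :
    ∃ ψ : ℝ → ℝ, Continuous ψ ∧ Monotone ψ ∧ (varyingSet ψ).Nonempty ∧
      interior (varyingSet ψ) = ∅ := by
  obtain ⟨U, hQU, hU, hvol⟩ := (range ((↑) : ℚ → ℝ)).exists_isOpen_lt_of_lt (μ := volume) 1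
    (by rw [(countable_range _).measure_zero]; exact one_pos)
  set F : ℝ → ℝ := Uᶜ.indicator 1 with hF
  have hF0 : 0 ≤ F := indicator_nonneg fun _ _ => zero_le_one
  have hmeas : MeasurableSet Uᶜ := hU.measurableSet.compl
  have hint : ∀ a b, IntervalIntegrable F volume a b := fun a b =>
    ⟨(integrable_const (1 : ℝ)).indicator hmeas, (integrable_const (1 : ℝ)).indicator hmeas⟩
  set ψ : ℝ → ℝ := fun x => ∫ t in (0 : ℝ)..x, F t with hψ
  have hsub : ∀ x y, ψ y - ψ x = ∫ t in x..y, F t := fun x y =>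
    intervalIntegral.integral_interval_sub_left (hint _ _) (hint _ _)
  have hcont : Continuous ψ := intervalIntegral.continuous_primitive hint 0
  have hmono : Monotone ψ := fun x y hxy => by
    have := intervalIntegral.integral_nonneg_of_forall (μ := volume) hxy hF0
    linarith [hsub x y]
  have hlt : ψ 0 < ψ 1 := by
    have hpos : volume (Uᶜ ∩ Ioc (0 : ℝ) 1) ≠ 0 := fun h0 => by
      have h1 : volume (Ioc (0 : ℝ) 1) ≤ volume (Uᶜ ∩ Ioc (0 : ℝ) 1) + volume U :=
        (measure_mono fun x hx => (em (x ∈ U)).elim Or.inr fun h => Or.inl ⟨h, hx⟩).trans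
          (measure_union_le _ _)
      rw [h0, zero_add, Real.volume_Ioc, sub_zero, ENNReal.ofReal_one] at h1
      exact h1.not_gt hvol
    have hfin : volume (Uᶜ ∩ Ioc (0 : ℝ) 1) ≠ ⊤ :=
      measure_ne_top_of_subset inter_subset_right measure_Ioc_lt_top.ne
    rw [← sub_pos, hsub, intervalIntegral.integral_of_le zero_le_one,
      integral_indicator_one hmeas, measureReal_restrict_apply hmeas]
    exact ENNReal.toReal_pos hpos hfin
  refine ⟨ψ, hcont, hmono, ?_, ?_⟩
  · obtain ⟨r, hr, -⟩ := exists_mem_varyingSet_eq hcont zero_le_one hlt le_rfl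
    exact ⟨r, hr⟩
  · rw [← not_nonempty_iff_eq_empty]
    rintro hne
    obtain ⟨q, hq⟩ := Rat.denseRange_cast.exists_mem_open isOpen_interior hne
    refine interior_subset hq ?_
    obtain ⟨ρ, hρ, hball⟩ := Metric.isOpen_iff.1 hU _ (hQU ⟨q, rfl⟩)
    filter_upwards [Metric.ball_mem_nhds _ hρ] with y hy
    rw [← sub_eq_zero, hsub]
    refine intervalIntegral.integral_zero_ae (Eventually.of_forall fun z hz => ?_)
    refine indicator_of_notMem (not_not.2 (hball ?_)) _
    exact (convex_ball _ _).ordConnected.uIcc_subset (Metric.mem_ball_self hρ) hy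
      (uIoc_subset_uIcc hz)

lemma exists_tangents_on_both_sides {ψ h f : ℝ → ℝ} (hψ : Continuous ψ) (hmono : Monotone ψ)
    (hh : Continuous h)
    (hvalley : ∀ α β, α < β → ∃ a b c, α < a ∧ a < b ∧ b < c ∧ c < β ∧ h b < h a ∧ h b < h c)
    (hf : ∀ a b, f b - f a = ∫ t in a..b, h (ψ t)) {x ρ : ℝ} (hx : x ∈ varyingSet ψ)
    (hρ : 0 < ρ) :
    ∃ a b c, a ∈ varyingSet ψ ∧ b ∈ varyingSet ψ ∧ c ∈ varyingSet ψ ∧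
      x - ρ < a ∧ a < b ∧ b < c ∧ c < x + ρ ∧
      f b < f a + h (ψ a) * (b - a) ∧ f c + h (ψ c) * (b - c) < f b := by
  obtain ⟨s, t, hs, hst, ht, hlt⟩ := exists_lt_of_mem_varyingSet hmono hx hρ
  obtain ⟨u, v, w, hu, huv, hvw, hw, hvu, hvw'⟩ := hvalley _ _ hlt
  obtain ⟨u', hu', hu'max⟩ := isCompact_Icc.exists_isMaxOn (nonempty_Icc.2 huv.le)
    hh.continuousOn
  obtain ⟨w', hw', hw'max⟩ := isCompact_Icc.exists_isMaxOn (nonempty_Icc.2 hvw.le)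
    hh.continuousOn
  have hu'v : h v < h u' := hvu.trans_le (hu'max (left_mem_Icc.2 huv.le))
  have hw'v : h v < h w' := hvw'.trans_le (hw'max (right_mem_Icc.2 hvw.le))
  have hu'lt : u' < v := lt_of_le_of_ne hu'.2 (by rintro rfl; exact hu'v.false)
  have hw'lt : v < w' := lt_of_le_of_ne hw'.1 (by rintro rfl; exact hw'v.false)
  obtain ⟨a, ha, hsa, -, hau⟩ := exists_mem_varyingSet_eq (u := u') hψ hst.le
    (hu.trans_le hu'.1) (by linarith [hu'.2])
  obtain ⟨b, hb, -, -, hbv⟩ := exists_mem_varyingSet_eq (u := v) hψ hst.le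
    (by linarith) (by linarith)
  obtain ⟨c, hc, -, hct, hcw⟩ := exists_mem_varyingSet_eq (u := w') hψ hst.le
    (by linarith) (by linarith [hw'.2])
  have hab : a < b := hmono.reflect_lt (by rw [hau, hbv]; exact hu'lt)
  have hbc : b < c := hmono.reflect_lt (by rw [hbv, hcw]; exact hw'lt)
  have hcont : Continuous fun t => h (ψ t) := hh.comp hψ
  refine ⟨a, b, c, ha, hb, hc, by linarith, hab, hbc, by linarith, ?_, ?_⟩
  · have := intervalIntegral.integral_lt_integral_of_continuousOn_of_le_of_exists_lt hab
      hcont.continuousOn (continuousOn_const (c := h (ψ a)))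
      (fun y hy => by
        rw [hau]
        exact hu'max ⟨hu'.1.trans (hau ▸ hmono hy.1.le), hbv ▸ hmono hy.2⟩)
      ⟨b, right_mem_Icc.2 hab.le, by rw [hau, hbv]; exact hu'v⟩
    rw [← hf, intervalIntegral.integral_const, smul_eq_mul] at this
    linarith
  · have := intervalIntegral.integral_lt_integral_of_continuousOn_of_le_of_exists_lt hbc
      hcont.continuousOn (continuousOn_const (c := h (ψ c)))
      (fun y hy => by
        rw [hcw]
        exact hw'max ⟨hbv ▸ hmono hy.1.le, (hcw ▸ hmono hy.2 : ψ y ≤ w').trans hw'.2⟩)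
      ⟨b, left_mem_Icc.2 hbc.le, by rw [hcw, hbv]; exact hw'v⟩
    rw [← hf, intervalIntegral.integral_const, smul_eq_mul] at this
    linarith

lemma exists_tangent_through {ψ h f : ℝ → ℝ} (hψ : Continuous ψ) (hmono : Monotone ψ)
    (hh : Continuous h) (hfc : Continuous f) (hf : ∀ a b, f b - f a = ∫ t in a..b, h (ψ t))
    {a c t y : ℝ} (ha : a ∈ varyingSet ψ) (hac : a ≤ c) (hy : y ≤ f a + h (ψ a) * (t - a))
    (hy' : f c + h (ψ c) * (t - c) ≤ y) :
    ∃ r ∈ varyingSet ψ, a ≤ r ∧ r ≤ c ∧ f r + h (ψ r) * (t - r) = y := by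
  obtain ⟨d, hd, hdy⟩ := intermediate_value_Icc' (f := fun d => f d + h (ψ d) * (t - d)) hac
    (by fun_prop) ⟨hy', hy⟩
  have hconst : ∀ r, ψ r = ψ d → f r + h (ψ r) * (t - r) = y := by
    intro r hr
    have : f d - f r = h (ψ d) * (d - r) := by
      rw [hf, intervalIntegral.integral_congr (g := fun _ => h (ψ d)),
        intervalIntegral.integral_const, smul_eq_mul, mul_comm]
      intro z hz
      have hz' := hmono.image_uIcc_subset (mem_image_of_mem ψ hz)
      rw [hr, uIcc_self] at hz'
      exact congrArg h hz'
    rw [← hdy, hr]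
    linarith
  rcases (hmono hd.1).eq_or_lt with h0 | h0
  · exact ⟨a, ha, le_rfl, hac, hconst a h0⟩
  · obtain ⟨r, hr, har, hrc, hrd⟩ := exists_mem_varyingSet_eq hψ hac h0 (hmono hd.2)
    exact ⟨r, hr, har, hrc, hconst r hrd⟩

/-- If every graph point over a nonempty closed set is a discontinuity of `g`, then some
quantitative form of this, together with control of `g` on the tangent segments, holds on a
relatively somewhere dense subset. -/
lemma exists_uniform_discontinuity {C : Set ℝ} (hC : IsClosed C) (hne : C.Nonempty)
    {p f : ℝ → ℝ} {g : ℝ × ℝ → ℝ} (hg : LinearlyContinuous2 g)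
    (hdisc : ∀ x ∈ C, ¬ ContinuousAt g (x, f x)) :
    ∃ ε > 0, ∃ δ > 0, ∃ q : ℝ, ∃ S : Set ℝ,
      (∀ x ∈ S, ∀ t, |t - x| < δ → |g (t, f x + p x * (t - x)) - q| ≤ ε) ∧
      (∀ x ∈ S, ¬ ∀ᶠ z in 𝓝 (x, f x), |g z - g (x, f x)| ≤ 2 * ε) ∧
      ∃ x ∈ C, ∃ η > 0, ∀ y ∈ C, |y - x| < η → y ∈ closure S := by
  let S : ℕ × ℕ × ℚ → Set ℝ := fun i =>
    {x | (∀ t, |t - x| < 1 / ((i.2.1 : ℝ) + 1) →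
        |g (t, f x + p x * (t - x)) - i.2.2| ≤ 1 / ((i.1 : ℝ) + 1)) ∧
      ¬ ∀ᶠ z in 𝓝 (x, f x), |g z - g (x, f x)| ≤ 2 * (1 / ((i.1 : ℝ) + 1))}
  have hcover : ∀ x ∈ C, ∃ i, x ∈ S i := by
    intro x hx
    obtain ⟨ε, hε, hxε⟩ : ∃ ε > 0, ¬ ∀ᶠ z in 𝓝 (x, f x), |g z - g (x, f x)| < ε := by
      have := hdisc x hx
      rw [ContinuousAt, Metric.tendsto_nhds] at this
      push Not at this
      simpa [Real.dist_eq] using this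
    obtain ⟨m, hm⟩ := exists_nat_one_div_lt (half_pos hε)
    have hm0 : 0 < 1 / ((m : ℝ) + 1) := by positivity
    obtain ⟨q, hq, hq'⟩ := exists_rat_btwn
      (show g (x, f x) - 1 / ((m : ℝ) + 1) < g (x, f x) by linarith)
    have hline : Continuous fun s : ℝ => g ((x, f x) + s • ((1 : ℝ), p x)) := hg _ _
    have hnear : ∀ᶠ s in 𝓝 (0 : ℝ), |g ((x, f x) + s • ((1 : ℝ), p x)) - q| <
        1 / ((m : ℝ) + 1) := by
      refine (hline.sub continuous_const).abs.continuousAt.eventually_lt continuousAt_const ?_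
      change |g ((x, f x) + (0 : ℝ) • ((1 : ℝ), p x)) - q| < _
      rw [zero_smul, add_zero, abs_lt]
      constructor <;> linarith
    obtain ⟨η, hη, hηline⟩ := Metric.eventually_nhds_iff.1 hnear
    obtain ⟨k, hk⟩ := exists_nat_one_div_lt hη
    refine ⟨(m, k, q), fun t ht => ?_, fun hev => hxε ?_⟩
    · have := hηline (y := t - x) (by rw [Real.dist_eq, sub_zero]; exact ht.trans hk)
      simp only [Prod.smul_mk, Prod.mk_add_mk, smul_eq_mul, mul_one, add_sub_cancel] at this
      rw [mul_comm (p x)]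
      exact this.le
    · filter_upwards [hev] with z hz
      have hz' : |g z - g (x, f x)| ≤ 2 * (1 / ((m : ℝ) + 1)) := hz
      linarith
  have := hne.to_subtype
  have : CompleteSpace C := hC.completeSpace_coe
  obtain ⟨i, ⟨x, hxC⟩, hx⟩ := nonempty_interior_of_iUnion_of_closed
    (f := fun i => ((↑) : C → ℝ) ⁻¹' closure (S i))
    (fun i => isClosed_closure.preimage continuous_subtype_val)
    (iUnion_eq_univ_iff.2 fun x => (hcover x x.2).imp fun i hi => subset_closure hi)
  obtain ⟨η, hη, hball⟩ := Metric.mem_nhds_iff.1 (mem_interior_iff_mem_nhds.1 hx)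
  exact ⟨1 / ((i.1 : ℝ) + 1), by positivity, 1 / ((i.2.1 : ℝ) + 1), by positivity, i.2.2, S i,
    fun y hy => hy.1, fun y hy => hy.2, x, hxC, η, hη, fun y hy hyx => @hball ⟨y, hy⟩ hyx⟩

lemma not_forall_discontinuous_on_graph {ψ h f : ℝ → ℝ} (hψ : Continuous ψ)
    (hmono : Monotone ψ) (hne : (varyingSet ψ).Nonempty) (hh : Continuous h)
    (hvalley : ∀ α β, α < β → ∃ a b c, α < a ∧ a < b ∧ b < c ∧ c < β ∧ h b < h a ∧ h b < h c)
    (hfc : Continuous f) (hf : ∀ a b, f b - f a = ∫ t in a..b, h (ψ t))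
    {g : ℝ × ℝ → ℝ} (hg : LinearlyContinuous2 g) :
    ¬ ∀ x ∈ varyingSet ψ, ¬ ContinuousAt g (x, f x) := by
  intro hdisc
  obtain ⟨ε, hε, δ, hδ, q, S, hS, hSosc, x, hx, η, hη, hdense⟩ :=
    exists_uniform_discontinuity (p := fun x => h (ψ x)) (isClosed_varyingSet ψ) hne hg hdisc
  obtain ⟨ρ, hρ, hρmin⟩ := exists_between (lt_min (half_pos hδ) hη)
  obtain ⟨hρδ, hρη⟩ := lt_min_iff.1 hρmin
  obtain ⟨a, b, c, ha, hb, -, hxa, hab, hbc, hcx, hba, hbc'⟩ :=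
    exists_tangents_on_both_sides hψ hmono hh hvalley hf hx hρ
  have hclosure : ∀ r ∈ varyingSet ψ, x - ρ < r → r < x + ρ →
      r ∈ closure (Ioo (x - ρ) (x + ρ) ∩ S) := fun r hr h1 h2 =>
    isOpen_Ioo.inter_closure ⟨⟨h1, h2⟩,
      hdense r hr ((abs_lt.2 ⟨by linarith, by linarith⟩ : |r - x| < ρ).trans hρη)⟩
  let N : Set (ℝ × ℝ) := {z | z.1 ∈ Ioo (x - ρ) (x + ρ) ∧
    z.2 < f a + h (ψ a) * (z.1 - a) ∧ f c + h (ψ c) * (z.1 - c) < z.2}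
  have htangent : ∀ d, Continuous fun z : ℝ × ℝ => f d + h (ψ d) * (z.1 - d) := by fun_prop
  have hNopen : IsOpen N :=
    (isOpen_Ioo.preimage continuous_fst).inter
      ((isOpen_lt continuous_snd (htangent a)).inter (isOpen_lt (htangent c) continuous_snd))
  have hbN : (b, f b) ∈ N := ⟨⟨by linarith, by linarith⟩, hba, hbc'⟩
  have hbound : ∀ z ∈ N, |g z - q| ≤ ε := by
    rintro ⟨t, y⟩ ⟨ht, hya, hyc⟩
    obtain ⟨r, hr, har, hrc, hry⟩ := exists_tangent_through hψ hmono hh hfc hf ha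
      (hab.trans hbc).le hya.le hyc.le
    dsimp only at ht hry
    rw [← hry]
    have hvert : Continuous fun s : ℝ => g (t, s) := by
      simpa using hg (t, 0) (0, 1)
    have hclosed : IsClosed {d | |g (t, f d + h (ψ d) * (t - d)) - q| ≤ ε} :=
      isClosed_le ((hvert.comp (f := fun d => f d + h (ψ d) * (t - d))
        (by fun_prop)).sub continuous_const).abs continuous_const
    refine closure_minimal ?_ hclosed (hclosure r hr (by linarith) (by linarith))
    rintro d ⟨⟨hd, hd'⟩, hdS⟩
    exact hS d hdS t (abs_lt.2 ⟨by linarith [ht.1], by linarith [ht.2]⟩)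
  obtain ⟨d, hdN, -, hdS⟩ := mem_closure_iff.1 (hclosure b hb (by linarith) (by linarith))
    ((fun s => (s, f s)) ⁻¹' N) (hNopen.preimage (by fun_prop)) hbN
  refine hSosc d hdS ?_
  filter_upwards [hNopen.mem_nhds hdN] with z hz
  have h1 := abs_le.1 (hbound z hz)
  have h2 := abs_le.1 (hbound _ hdN)
  exact abs_le.2 ⟨by linarith, by linarith⟩

lemma isNowhereDense_graph_preimage {f : ℝ → ℝ} (hf : Continuous f) {C : Set ℝ}
    (hC : IsClosed C) (hint : interior C = ∅) :
    IsNowhereDense ((Subtype.val ⁻¹' {z : ℝ × ℝ | z.1 ∈ C ∧ z.2 = f z.1}) :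
      Set {p : ℝ × ℝ | p.2 = f p.1}) := by
  have heq : ((Subtype.val ⁻¹' {z : ℝ × ℝ | z.1 ∈ C ∧ z.2 = f z.1}) :
      Set {p : ℝ × ℝ | p.2 = f p.1}) = (fun z => z.1.1) ⁻¹' C := by
    ext z
    exact ⟨fun hz => hz.1, fun hz => ⟨hz, z.2⟩⟩
  rw [heq, IsNowhereDense, (hC.preimage (by fun_prop)).closure_eq, ← not_nonempty_iff_eq_empty]
  rintro ⟨z, hz⟩
  let e : ℝ → {p : ℝ × ℝ | p.2 = f p.1} := fun x => ⟨(x, f x), rfl⟩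
  have he : Continuous e := by fun_prop
  have hez : e z.1.1 = z := Subtype.ext (Prod.ext rfl z.2.symm)
  have hmem : z.1.1 ∈ interior C := by
    refine interior_maximal (fun x hx => ?_) (isOpen_interior.preimage he)
      (show e z.1.1 ∈ _ by rw [hez]; exact hz)
    exact interior_subset (s := (fun z : {p : ℝ × ℝ | p.2 = f p.1} => z.1.1) ⁻¹' C) hx
  rw [hint] at hmem
  exact hmem

theorem stmt_16 :
    ∃ f : ℝ → ℝ, Differentiable ℝ f ∧ (∃ C : ℝ, ∀ x, |deriv f x| ≤ C) ∧
      ∃ M : Set (ℝ × ℝ), M ⊆ {p : ℝ × ℝ | p.2 = f p.1} ∧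
        IsNowhereDense ((Subtype.val ⁻¹' M) : Set {p : ℝ × ℝ | p.2 = f p.1}) ∧
        ¬ ∃ g : ℝ × ℝ → ℝ, LinearlyContinuous2 g ∧ M ⊆ {p | ¬ ContinuousAt g p} := by
  obtain ⟨ψ, hψ, hmono, hne, hint⟩ := exists_cantor_like_function
  have hcont : Continuous fun t => takagi (ψ t) := continuous_takagi.comp hψ
  set f : ℝ → ℝ := fun x => ∫ t in (0 : ℝ)..x, takagi (ψ t)
  have hderiv : ∀ x, HasDerivAt f (takagi (ψ x)) x := fun x =>
    intervalIntegral.integral_hasDerivAt_right (hcont.intervalIntegrable _ _)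
      hcont.stronglyMeasurable.stronglyMeasurableAtFilter hcont.continuousAt
  have hdiff : Differentiable ℝ f := fun x => (hderiv x).differentiableAt
  have hf : ∀ a b, f b - f a = ∫ t in a..b, takagi (ψ t) := fun a b =>
    intervalIntegral.integral_interval_sub_left (hcont.intervalIntegrable _ _)
      (hcont.intervalIntegrable _ _)
  refine ⟨f, hdiff, ⟨2, fun x => by rw [(hderiv x).deriv]; exact abs_takagi_le _⟩,
    {z | z.1 ∈ varyingSet ψ ∧ z.2 = f z.1}, fun z hz => hz.2,
    isNowhereDense_graph_preimage hdiff.continuous (isClosed_varyingSet ψ) hint, ?_⟩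
  rintro ⟨g, hg, hM⟩
  exact not_forall_discontinuous_on_graph hψ hmono hne continuous_takagi
    (fun _ _ => exists_valley_takagi) hdiff.continuous hf hg
    fun x hx => hM (show (x, f x) ∈ _ from ⟨hx, rfl⟩)
end

section
/- Let f ∈ C¹[0,1], let P ⊂ [0,1] be a closed nowhere dense set, and let a, b ∈ ℝ. Then the set {a·x + b·f(x) : x ∈ P} is nowhere dense in ℝ. -/
/-- A continuous injective image of the trace of a set with empty interior on a nondegenerate
compact interval has empty interior. -/
lemma interior_image_inter_Icc_eq_empty {g : ℝ → ℝ} {c d : ℝ} (hcd : c < d)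
    (hg : ContinuousOn g (Set.Icc c d)) (hinj : Set.InjOn g (Set.Icc c d)) {P : Set ℝ}
    (hP : interior P = ∅) : interior (g '' (P ∩ Set.Icc c d)) = ∅ := by
  by_contra hne
  obtain ⟨y, hy⟩ := Set.nonempty_iff_ne_empty.mpr hne
  obtain ⟨x, ⟨-, hx⟩, rfl⟩ := interior_subset hy
  obtain ⟨W, hW, hWeq⟩ := continuousOn_iff'.mp hg _ (isOpen_interior (s := g '' (P ∩ Set.Icc c d)))
  have hxW : x ∈ W := (hWeq.subset ⟨hy, hx⟩).1
  have hxcl : x ∈ closure (Set.Ioo c d) := by rwa [closure_Ioo hcd.ne]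
  obtain ⟨z, hzW, hz⟩ := mem_closure_iff.mp hxcl W hW hxW
  have hsub : W ∩ Set.Ioo c d ⊆ P := by
    rintro w ⟨hwW, hw⟩
    have hwI := Set.Ioo_subset_Icc_self hw
    obtain ⟨v, ⟨hvP, hv⟩, hvw⟩ := interior_subset (hWeq.superset ⟨hwW, hwI⟩).1
    rwa [← hinj hv hwI hvw]
  have hzP : z ∈ interior P := interior_maximal hsub (hW.inter isOpen_Ioo) ⟨hzW, hz⟩
  simp [hP] at hzP

/-- A function whose derivative does not vanish on an interval is injective there. -/
lemma injOn_Icc_of_hasDerivWithinAt_ne_zero {g g' : ℝ → ℝ} {c d : ℝ}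
    (hg : ∀ x ∈ Set.Icc c d, HasDerivWithinAt g (g' x) (Set.Icc c d) x)
    (hne : ∀ x ∈ Set.Icc c d, g' x ≠ 0) : Set.InjOn g (Set.Icc c d) := by
  have key : ∀ x ∈ Set.Icc c d, ∀ y ∈ Set.Icc c d, x < y → g x ≠ g y := by
    intro x hx y hy hxy heq
    have hsub : Set.Icc x y ⊆ Set.Icc c d := Set.Icc_subset_Icc hx.1 hy.2
    have hcont : ContinuousOn g (Set.Icc x y) := fun z hz =>
      (hg z (hsub hz)).continuousWithinAt.mono hsub
    obtain ⟨z, hz, hz0⟩ := exists_hasDerivAt_eq_zero hxy hcont heq fun z hz =>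
      (hg z (hsub (Set.Ioo_subset_Icc_self hz))).hasDerivAt
        (Icc_mem_nhds (hx.1.trans_lt hz.1) (hz.2.trans_le hy.2))
    exact hne z (hsub (Set.Ioo_subset_Icc_self hz)) hz0
  intro x hx y hy heq
  rcases lt_trichotomy x y with h | h | h
  · exact absurd heq (key x hx y hy h)
  · exact h
  · exact absurd heq.symm (key y hy x hx h)

/-- One-dimensional Sard: the set of critical values on a set is null. -/
lemma volume_image_eq_zero_of_hasDerivWithinAt_zero {g : ℝ → ℝ} {s : Set ℝ}
    (hg : ∀ x ∈ s, HasDerivWithinAt g 0 s x) : MeasureTheory.volume (g '' s) = 0 := by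
  refine MeasureTheory.addHaar_image_eq_zero_of_det_fderivWithin_eq_zero MeasureTheory.volume
    (f' := fun _ => 0) (fun x hx => ?_) (fun x _ => ?_)
  · simpa [hasDerivWithinAt_iff_hasFDerivWithinAt] using hg x hx
  · simp [ContinuousLinearMap.det]

/-- A `C¹` function on `[0, 1]` maps closed nowhere dense subsets to nowhere dense sets. -/
lemma IsNowhereDense.image_of_hasDerivWithinAt {g g' : ℝ → ℝ}
    (hg : ∀ x ∈ Set.Icc (0:ℝ) 1, HasDerivWithinAt g (g' x) (Set.Icc (0:ℝ) 1) x)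
    (hg' : ContinuousOn g' (Set.Icc (0:ℝ) 1)) {P : Set ℝ} (hP : P ⊆ Set.Icc (0:ℝ) 1)
    (hPclosed : IsClosed P) (hPnd : IsNowhereDense P) : IsNowhereDense (g '' P) := by
  have hcont : ContinuousOn g (Set.Icc 0 1) := fun x hx => (hg x hx).continuousWithinAt
  have hint : interior P = ∅ := hPclosed.isNowhereDense_iff.mp hPnd
  have hPc : IsCompact P := isCompact_Icc.of_isClosed_subset hPclosed hP
  have hclosed : IsClosed (g '' P) := (hPc.image_of_continuousOn (hcont.mono hP)).isClosed
  set K : Set ℝ := Set.Icc 0 1 ∩ g' ⁻¹' {0} with hK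
  have hKc : IsCompact K := isCompact_Icc.of_isClosed_subset
    (hg'.preimage_isClosed_of_isClosed isClosed_Icc isClosed_singleton) Set.inter_subset_left
  have hKm : IsMeagre (g '' K) := by
    refine IsNowhereDense.isMeagre ?_
    rw [(hKc.image_of_continuousOn (hcont.mono Set.inter_subset_left)).isClosed.isNowhereDense_iff]
    refine MeasureTheory.Measure.interior_eq_empty_of_null
      (volume_image_eq_zero_of_hasDerivWithinAt_zero fun x hx => ?_)
    have h0 : g' x = 0 := hx.2
    exact h0 ▸ (hg x hx.1).mono Set.inter_subset_left
  let I : ℚ × ℚ → Set ℝ := fun r => Set.Icc (max (r.1 : ℝ) 0) (min (r.2 : ℝ) 1)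
  have hI : ∀ r, I r ⊆ Set.Icc 0 1 := fun r =>
    Set.Icc_subset_Icc (le_max_right _ _) (min_le_right _ _)
  let J : Set (ℚ × ℚ) := {r | max (r.1 : ℝ) 0 < min (r.2 : ℝ) 1 ∧ ∀ x ∈ I r, g' x ≠ 0}
  have hJm : IsMeagre (⋃ r : J, g '' (P ∩ I r)) := by
    refine isMeagre_iUnion fun r => IsNowhereDense.isMeagre ?_
    have hc : IsClosed (g '' (P ∩ I r)) := ((hPc.inter_right isClosed_Icc).image_of_continuousOn
      (hcont.mono (Set.inter_subset_left.trans hP))).isClosed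
    rw [hc.isNowhereDense_iff]
    exact interior_image_inter_Icc_eq_empty r.2.1 (hcont.mono (hI r))
      (injOn_Icc_of_hasDerivWithinAt_ne_zero (fun x hx => (hg x (hI r hx)).mono (hI r)) r.2.2) hint
  have hcover : g '' P ⊆ g '' K ∪ ⋃ r : J, g '' (P ∩ I r) := by
    rintro _ ⟨x, hx, rfl⟩
    by_cases h0 : g' x = 0
    · exact Or.inl ⟨x, ⟨hP hx, h0⟩, rfl⟩
    · have hev := (hg' x (hP hx)).eventually_ne h0
      obtain ⟨ε, hε, hball⟩ := Metric.mem_nhdsWithin_iff.mp hev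
      obtain ⟨p, hp1, hp2⟩ := exists_rat_btwn (sub_lt_self x hε)
      obtain ⟨q, hq1, hq2⟩ := exists_rat_btwn (lt_add_of_pos_right x hε)
      have hx01 := hP hx
      refine Or.inr (Set.mem_iUnion.mpr ⟨⟨(p, q), ?_, fun z hz => ?_⟩, x, ⟨hx, ?_, ?_⟩, rfl⟩)
      · exact max_lt (lt_min (hp2.trans hq1) (hp2.trans_le hx01.2))
          (lt_min (hx01.1.trans_lt hq1) one_pos)
      · refine hball ⟨?_, hI _ hz⟩
        rw [Real.ball_eq_Ioo]
        exact ⟨hp1.trans_le ((le_max_left _ _).trans hz.1),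
          (hz.2.trans (min_le_left _ _)).trans_lt hq2⟩
      · exact max_le hp2.le hx01.1
      · exact le_min hq1.le hx01.2
  rw [hclosed.isNowhereDense_iff, interior_eq_empty_iff_dense_compl]
  exact dense_of_mem_residual ((hKm.union hJm).mono hcover)

theorem stmt_18 (f f' : ℝ → ℝ)
    (hf : ∀ x ∈ Set.Icc (0:ℝ) 1, HasDerivWithinAt f (f' x) (Set.Icc (0:ℝ) 1) x)
    (hfc : ContinuousOn f' (Set.Icc (0:ℝ) 1))
    (P : Set ℝ) (hP : P ⊆ Set.Icc (0:ℝ) 1) (hPclosed : IsClosed P)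
    (hPnd : IsNowhereDense P) (a b : ℝ) :
    IsNowhereDense ((fun x => a * x + b * f x) '' P) := by
  refine IsNowhereDense.image_of_hasDerivWithinAt (g' := fun x => a * 1 + b * f' x)
    (fun x hx => ?_) (by fun_prop) hP hPclosed hPnd
  exact ((hasDerivWithinAt_id x _).const_mul a).add ((hf x hx).const_mul b)
end

section
/- Let f ∈ C¹[0,1], let P ⊂ [0,1] be a nonempty closed nowhere dense set, and let c = (c₁, c₂) ∈ ℝ² be a point with c ∉ {(x, f(x)) : x ∈ P}. Then the set F = { (x − c₁)/√((x − c₁)² + (f(x) − c₂)²) : x ∈ P } is nowhere dense in ℝ. -/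
/-- A map with a nonzero strict derivative at `x` sends the part near `x` of a closed nowhere dense
set to a nowhere dense set. -/
lemma HasStrictDerivAt.exists_mem_nhds_isNowhereDense_image {g : ℝ → ℝ} {d x : ℝ}
    (hg : HasStrictDerivAt g d x) (hd : d ≠ 0) {P : Set ℝ} (hP : IsClosed P)
    (hnd : IsNowhereDense P) : ∃ U ∈ nhds x, IsNowhereDense (g '' (P ∩ U)) := by
  have hF := hg.hasStrictFDerivAt_equiv hd
  set e := hF.toOpenPartialHomeomorph g
  have hcoe : (e : ℝ → ℝ) = g := hF.toOpenPartialHomeomorph_coe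
  obtain ⟨U, ⟨hxU, hUc⟩, hUs⟩ := (compact_basis_nhds x).mem_iff.1
    (e.open_source.mem_nhds hF.mem_toOpenPartialHomeomorph_source)
  refine ⟨U, hxU, ?_⟩
  have hsub : P ∩ U ⊆ e.source := Set.inter_subset_right.trans hUs
  have hclosed : IsClosed (g '' (P ∩ U)) := by
    rw [← hcoe]
    exact ((hUc.inter_left hP).image_of_continuousOn (e.continuousOn.mono hsub)).isClosed
  have hint : interior P = ∅ := hP.isNowhereDense_iff.1 hnd
  rw [hclosed.isNowhereDense_iff]
  have htarget : interior (g '' (P ∩ U)) ⊆ e.target := by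
    rintro _ hy
    obtain ⟨z, hz, rfl⟩ := interior_subset hy
    rw [← hcoe]
    exact e.map_source (hsub hz)
  have hopen : IsOpen (e.symm '' interior (g '' (P ∩ U))) :=
    e.symm.isOpen_image_of_subset_source isOpen_interior htarget
  have hPsub : e.symm '' interior (g '' (P ∩ U)) ⊆ P := by
    rintro _ ⟨y, hy, rfl⟩
    obtain ⟨z, hz, rfl⟩ := interior_subset hy
    rw [← hcoe, e.left_inv (hsub hz)]
    exact hz.1
  have := hopen.subset_interior_iff.2 hPsub
  rw [hint, Set.subset_empty_iff, Set.image_eq_empty] at this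
  exact this

/-- A map that is continuously differentiable along a compact nowhere dense set `P`, and strictly
differentiable at all but countably many points of `P`, sends `P` to a nowhere dense set. -/
lemma IsCompact.isNowhereDense_image_of_hasDerivWithinAt {g g' : ℝ → ℝ} {P C : Set ℝ}
    (hP : IsCompact P) (hnd : IsNowhereDense P) (hC : C.Countable)
    (hg : ∀ x ∈ P, HasDerivWithinAt g (g' x) P x) (hg' : ContinuousOn g' P)
    (hs : ∀ x ∈ P \ C, HasStrictDerivAt g (g' x) x) : IsNowhereDense (g '' P) := by
  have hgc : ContinuousOn g P := fun x hx => (hg x hx).continuousWithinAt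
  rw [(hP.image_of_continuousOn hgc).isClosed.isNowhereDense_iff]
  by_contra hne
  refine not_isMeagre_of_isOpen isOpen_interior (Set.nonempty_iff_ne_empty.2 hne)
    (IsMeagre.mono interior_subset ?_)
  have hcrit : IsMeagre (g '' (P ∩ g' ⁻¹' {0})) := by
    have hK : IsCompact (P ∩ g' ⁻¹' {0}) :=
      hP.of_isClosed_subset (hg'.preimage_isClosed_of_isClosed hP.isClosed isClosed_singleton)
        Set.inter_subset_left
    refine (IsNowhereDense.of_isClosed_null (μ := MeasureTheory.volume)
      (hK.image_of_continuousOn (hgc.mono Set.inter_subset_left)).isClosed ?_).isMeagre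
    refine MeasureTheory.addHaar_image_eq_zero_of_det_fderivWithin_eq_zero MeasureTheory.volume
      (fun x hx => ((hg x hx.1).mono Set.inter_subset_left).hasFDerivWithinAt) ?_
    rintro x ⟨-, hx⟩
    have hx0 : g' x = 0 := hx
    simp [hx0, ContinuousLinearMap.det]
  have hcount : IsMeagre (g '' C) := by
    rw [← Set.biUnion_of_singleton (g '' C), Set.biUnion_eq_iUnion]
    have := (hC.image g).to_subtype
    exact isMeagre_iUnion fun y => IsNowhereDense.isMeagre <| by
      simp [IsNowhereDense]
  have hreg : IsMeagre (g '' ((P \ C) \ g' ⁻¹' {0})) := by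
    have hloc : ∀ x ∈ (P \ C) \ g' ⁻¹' {0}, ∃ U ∈ nhds x, IsNowhereDense (g '' (P ∩ U)) :=
      fun x hx => (hs x hx.1).exists_mem_nhds_isNowhereDense_image hx.2 hP.isClosed hnd
    choose! U hU hUn using hloc
    obtain ⟨t, hts, htc, hcov⟩ := TopologicalSpace.countable_cover_nhdsWithin
      fun x hx => mem_nhdsWithin_of_mem_nhds (hU x hx)
    have := htc.to_subtype
    refine IsMeagre.mono ?_ (isMeagre_iUnion fun x : t => (hUn x (hts x.2)).isMeagre)
    rintro _ ⟨x, hx, rfl⟩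
    obtain ⟨i, hi, hxi⟩ := Set.mem_iUnion₂.1 (hcov hx)
    exact Set.mem_iUnion.2 ⟨⟨i, hi⟩, x, ⟨hx.1.1, hxi⟩, rfl⟩
  refine ((hcrit.union hcount).union hreg).mono ?_
  rw [← Set.image_union, ← Set.image_union]
  refine Set.image_mono fun x hx => ?_
  by_cases h₁ : x ∈ C <;> by_cases h₂ : g' x = 0 <;> simp [h₁, h₂, hx]

theorem stmt_19 (f f' : ℝ → ℝ)
    (hf : ∀ x ∈ Set.Icc (0:ℝ) 1, HasDerivWithinAt f (f' x) (Set.Icc (0:ℝ) 1) x)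
    (hfc : ContinuousOn f' (Set.Icc (0:ℝ) 1))
    (P : Set ℝ) (hP : P ⊆ Set.Icc (0:ℝ) 1) (hPne : P.Nonempty)
    (hPclosed : IsClosed P) (hPnd : IsNowhereDense P)
    (c₁ c₂ : ℝ) (hc : ∀ x ∈ P, (x, f x) ≠ (c₁, c₂)) :
    IsNowhereDense
      ((fun x => (x - c₁) / Real.sqrt ((x - c₁) ^ 2 + (f x - c₂) ^ 2)) '' P) := by
  set q : ℝ → ℝ := fun x => (x - c₁) ^ 2 + (f x - c₂) ^ 2
  have hpos : ∀ x ∈ P, 0 < q x := by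
    intro x hx
    by_contra! h
    have h₁ : x - c₁ = 0 := by nlinarith [sq_nonneg (x - c₁), sq_nonneg (f x - c₂)]
    have h₂ : f x - c₂ = 0 := by nlinarith [sq_nonneg (x - c₁), sq_nonneg (f x - c₂)]
    exact hc x hx (Prod.ext (sub_eq_zero.1 h₁) (sub_eq_zero.1 h₂))
  have hfP : ContinuousOn f P := fun x hx => ((hf x (hP hx)).mono hP).continuousWithinAt
  have hstrict : ∀ x ∈ Set.Ioo (0:ℝ) 1, HasStrictDerivAt f (f' x) x := by
    intro x hx
    refine hasStrictDerivAt_of_hasDerivAt_of_continuousAt (f' := f') ?_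
      (hfc.continuousAt (Icc_mem_nhds hx.1 hx.2))
    filter_upwards [Ioo_mem_nhds hx.1 hx.2] with y hy
    exact (hf y (Set.Ioo_subset_Icc_self hy)).hasDerivAt (Icc_mem_nhds hy.1 hy.2)
  let q' : ℝ → ℝ := fun x => 2 * (x - c₁) + 2 * (f x - c₂) * f' x
  refine IsCompact.isNowhereDense_image_of_hasDerivWithinAt
    (g' := fun x => (1 * √(q x) - (x - c₁) * (q' x / (2 * √(q x)))) / √(q x) ^ 2)
    (C := {0, 1}) (isCompact_Icc.of_isClosed_subset hPclosed hP) hPnd (by simp) ?_ ?_ ?_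
  · intro x hx
    have hu : HasDerivWithinAt (fun x => x - c₁) 1 P x := (hasDerivWithinAt_id x P).sub_const c₁
    have hqd : HasDerivWithinAt q (q' x) P x := by
      refine ((hu.pow 2).add ((((hf x (hP hx)).mono hP).sub_const c₂).pow 2)).congr_deriv ?_
      simp [q']
    exact hu.div (hqd.sqrt (hpos x hx).ne') (Real.sqrt_pos.2 (hpos x hx)).ne'
  · have hf'P := hfc.mono hP
    have hqc : ContinuousOn (fun x => √(q x)) P := by fun_prop
    have hq'c : ContinuousOn q' P := by fun_prop
    have hne : ∀ x ∈ P, √(q x) ≠ 0 := fun x hx => (Real.sqrt_pos.2 (hpos x hx)).ne'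
    refine ContinuousOn.div (.sub (by fun_prop) (.mul (by fun_prop) (.div hq'c (by fun_prop) ?_)))
      (hqc.pow 2) ?_
    · exact fun x hx => mul_ne_zero two_ne_zero (hne x hx)
    · exact fun x hx => pow_ne_zero 2 (hne x hx)
  · rintro x ⟨hx, hxC⟩
    simp only [Set.mem_insert_iff, Set.mem_singleton_iff, not_or] at hxC
    have hfx := hstrict x ⟨lt_of_le_of_ne (hP hx).1 (Ne.symm hxC.1),
      lt_of_le_of_ne (hP hx).2 hxC.2⟩
    have hu : HasStrictDerivAt (fun x => x - c₁) 1 x := (hasStrictDerivAt_id x).sub_const c₁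
    have hqd : HasStrictDerivAt q (q' x) x := by
      refine ((hu.pow 2).add (HasStrictDerivAt.pow (hfx.sub_const c₂) 2)).congr_deriv ?_
      simp [q']
    have hsq : HasStrictDerivAt (fun x => √(q x)) (q' x / (2 * √(q x))) x :=
      ((Real.hasStrictDerivAt_sqrt (hpos x hx).ne').comp x hqd).congr_deriv (by ring)
    exact hu.div hsq (Real.sqrt_pos.2 (hpos x hx)).ne'
end
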